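/- Let Y be a finite-dimensional representation of the Rudakov quiver Q_Rud over a field k. If Y is (e,f)-surjective, then Im(e'_Y) + Im(f'_Y) ⊆ ker(e_Y) + ker(f_Y). If Y is (e,f)-saturated, then e'_Y = 0 and f'_Y = 0. -/

import Mathlib

open scoped Classical
set_option maxHeartbeats 1000000

noncomputable section

/-- A finite-dimensional representation of the Rudakov quiver `Q_Rud` over a field `k`:
two finite-dimensional vector spaces `V₁`, `V₂`, maps `e f : V₁ → V₂` and
`e' f' : V₂ → V₁` satisfying `ee' = e'e = ff' = f'f = 0`, `ef' = -fe'`, `e'f = -f'e`. -/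
structure RudRep (k : Type) [Field k] : Type 1 where
  V₁ : Type
  V₂ : Type
  [acg₁ : AddCommGroup V₁]
  [acg₂ : AddCommGroup V₂]
  [mod₁ : Module k V₁]
  [mod₂ : Module k V₂]
  [fd₁ : FiniteDimensional k V₁]
  [fd₂ : FiniteDimensional k V₂]
  e : V₁ →ₗ[k] V₂
  f : V₁ →ₗ[k] V₂
  e' : V₂ →ₗ[k] V₁
  f' : V₂ →ₗ[k] V₁
  rel_ee' : e ∘ₗ e' = 0
  rel_e'e : e' ∘ₗ e = 0
  rel_ff' : f ∘ₗ f' = 0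
  rel_f'f : f' ∘ₗ f = 0
  rel_ef' : e ∘ₗ f' = -(f ∘ₗ e')
  rel_e'f : e' ∘ₗ f = -(f' ∘ₗ e)

attribute [instance] RudRep.acg₁ RudRep.acg₂ RudRep.mod₁ RudRep.mod₂ RudRep.fd₁ RudRep.fd₂

variable {k : Type} [Field k]

namespace RudRep

lemma ee'_apply (X : RudRep k) (y : X.V₂) : X.e (X.e' y) = 0 := by
  simpa using DFunLike.congr_fun X.rel_ee' y
lemma e'e_apply (X : RudRep k) (x : X.V₁) : X.e' (X.e x) = 0 := by
  simpa using DFunLike.congr_fun X.rel_e'e x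
lemma ff'_apply (X : RudRep k) (y : X.V₂) : X.f (X.f' y) = 0 := by
  simpa using DFunLike.congr_fun X.rel_ff' y
lemma f'f_apply (X : RudRep k) (x : X.V₁) : X.f' (X.f x) = 0 := by
  simpa using DFunLike.congr_fun X.rel_f'f x
lemma ef'_apply (X : RudRep k) (y : X.V₂) : X.e (X.f' y) = -(X.f (X.e' y)) := by
  simpa using DFunLike.congr_fun X.rel_ef' y
lemma e'f_apply (X : RudRep k) (x : X.V₁) : X.e' (X.f x) = -(X.f' (X.e x)) := by
  simpa using DFunLike.congr_fun X.rel_e'f x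

/-- The involution `σ` swapping the two vertices and interchanging `e ↔ e'`, `f ↔ f'`. -/
def sigma (X : RudRep k) : RudRep k where
  V₁ := X.V₂
  V₂ := X.V₁
  e := X.e'
  f := X.f'
  e' := X.e
  f' := X.f
  rel_ee' := X.rel_e'e
  rel_e'e := X.rel_ee'
  rel_ff' := X.rel_f'f
  rel_f'f := X.rel_ff'
  rel_ef' := X.rel_e'f
  rel_e'f := X.rel_ef'

/-- A representation is zero iff both underlying spaces are trivial. -/
def IsZero (X : RudRep k) : Prop := Subsingleton X.V₁ ∧ Subsingleton X.V₂

/-- Direct sum of two representations of the Rudakov quiver. -/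
def dsum (X Y : RudRep k) : RudRep k where
  V₁ := X.V₁ × Y.V₁
  V₂ := X.V₂ × Y.V₂
  e := X.e.prodMap Y.e
  f := X.f.prodMap Y.f
  e' := X.e'.prodMap Y.e'
  f' := X.f'.prodMap Y.f'
  rel_ee' := by
    apply LinearMap.ext; rintro ⟨a, b⟩
    simp [Prod.ext_iff, ee'_apply]
  rel_e'e := by
    apply LinearMap.ext; rintro ⟨a, b⟩
    simp [Prod.ext_iff, e'e_apply]
  rel_ff' := by
    apply LinearMap.ext; rintro ⟨a, b⟩
    simp [Prod.ext_iff, ff'_apply]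
  rel_f'f := by
    apply LinearMap.ext; rintro ⟨a, b⟩
    simp [Prod.ext_iff, f'f_apply]
  rel_ef' := by
    apply LinearMap.ext; rintro ⟨a, b⟩
    simp [Prod.ext_iff, ef'_apply]
  rel_e'f := by
    apply LinearMap.ext; rintro ⟨a, b⟩
    simp [Prod.ext_iff, e'f_apply]

/-- The zero representation. -/
def zeroRep (k : Type) [Field k] : RudRep k where
  V₁ := Fin 0 → k
  V₂ := Fin 0 → k
  e := 0
  f := 0
  e' := 0
  f' := 0
  rel_ee' := by simp
  rel_e'e := by simp
  rel_ff' := by simp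
  rel_f'f := by simp
  rel_ef' := by simp
  rel_e'f := by simp

/-- `n`-fold direct sum `X^{⊕ n}`. -/
def npow (X : RudRep k) : ℕ → RudRep k
  | 0 => zeroRep k
  | n + 1 => (npow X n).dsum X

end RudRep

/-- Morphisms of representations of `Q_Rud`, as a submodule of the product of Hom spaces:
pairs of linear maps commuting with `e, f, e', f'`. -/
def RudHomS (X Y : RudRep k) :
    Submodule k ((X.V₁ →ₗ[k] Y.V₁) × (X.V₂ →ₗ[k] Y.V₂)) where
  carrier := {p | Y.e ∘ₗ p.1 = p.2 ∘ₗ X.e ∧ Y.f ∘ₗ p.1 = p.2 ∘ₗ X.f ∧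
      Y.e' ∘ₗ p.2 = p.1 ∘ₗ X.e' ∧ Y.f' ∘ₗ p.2 = p.1 ∘ₗ X.f'}
  add_mem' := by
    intro a b ha hb
    obtain ⟨ha1, ha2, ha3, ha4⟩ := ha
    obtain ⟨hb1, hb2, hb3, hb4⟩ := hb
    refine ⟨?_, ?_, ?_, ?_⟩ <;>
      simp only [Prod.fst_add, Prod.snd_add, LinearMap.add_comp, LinearMap.comp_add,
        ha1, ha2, ha3, ha4, hb1, hb2, hb3, hb4]
  zero_mem' := by
    refine ⟨?_, ?_, ?_, ?_⟩ <;> simp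
  smul_mem' := by
    intro c a ha
    obtain ⟨h1, h2, h3, h4⟩ := ha
    refine ⟨?_, ?_, ?_, ?_⟩ <;>
      simp only [Prod.smul_fst, Prod.smul_snd, LinearMap.smul_comp, LinearMap.comp_smul,
        h1, h2, h3, h4]

/-- The space of morphisms of representations `X → Y`. -/
abbrev RudHom (X Y : RudRep k) : Type := ↥(RudHomS X Y)

private lemma square_comp
    {A₁ A₂ B₁ B₂ C₁ C₂ : Type}
    [AddCommGroup A₁] [AddCommGroup A₂] [AddCommGroup B₁] [AddCommGroup B₂]
    [AddCommGroup C₁] [AddCommGroup C₂]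
    [Module k A₁] [Module k A₂] [Module k B₁] [Module k B₂] [Module k C₁] [Module k C₂]
    (u : A₁ →ₗ[k] A₂) (v : B₁ →ₗ[k] B₂) (w : C₁ →ₗ[k] C₂)
    (h₁ : A₁ →ₗ[k] B₁) (h₂ : A₂ →ₗ[k] B₂) (g₁ : B₁ →ₗ[k] C₁) (g₂ : B₂ →ₗ[k] C₂)
    (hh : v ∘ₗ h₁ = h₂ ∘ₗ u) (hg : w ∘ₗ g₁ = g₂ ∘ₗ v) :
    w ∘ₗ (g₁ ∘ₗ h₁) = (g₂ ∘ₗ h₂) ∘ₗ u := by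
  apply LinearMap.ext
  intro x
  have e1 := DFunLike.congr_fun hh x
  have e2 := DFunLike.congr_fun hg (h₁ x)
  simp only [LinearMap.comp_apply] at e1 e2 ⊢
  rw [e2, e1]

/-- Composition of morphisms of representations. -/
def RudHom.comp {X Y Z : RudRep k} (g : RudHom Y Z) (h : RudHom X Y) : RudHom X Z := by
  refine ⟨(g.1.1 ∘ₗ h.1.1, g.1.2 ∘ₗ h.1.2), ?_⟩
  obtain ⟨hg1, hg2, hg3, hg4⟩ := g.2
  obtain ⟨hh1, hh2, hh3, hh4⟩ := h.2
  exact ⟨square_comp X.e Y.e Z.e h.1.1 h.1.2 g.1.1 g.1.2 hh1 hg1,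
    square_comp X.f Y.f Z.f h.1.1 h.1.2 g.1.1 g.1.2 hh2 hg2,
    square_comp X.e' Y.e' Z.e' h.1.2 h.1.1 g.1.2 g.1.1 hh3 hg3,
    square_comp X.f' Y.f' Z.f' h.1.2 h.1.1 g.1.2 g.1.1 hh4 hg4⟩

/-- The identity morphism. -/
def RudHom.idHom (X : RudRep k) : RudHom X X :=
  ⟨(LinearMap.id, LinearMap.id), by refine ⟨?_, ?_, ?_, ?_⟩ <;> simp⟩

/-- Two representations are isomorphic iff there is a morphism between them whose
components are bijective. -/
def RudIso (X Y : RudRep k) : Prop :=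
  ∃ g : RudHom X Y, Function.Bijective g.1.1 ∧ Function.Bijective g.1.2

/-- A representation is indecomposable if it is nonzero and any decomposition as a direct
sum has a trivial summand. -/
def RudRep.Indec (X : RudRep k) : Prop :=
  ¬ X.IsZero ∧ ∀ Y Z : RudRep k, RudIso X (Y.dsum Z) → Y.IsZero ∨ Z.IsZero

namespace RudRep

/-- Build a representation of `Q_Rud` from a representation of the Kronecker quiver,
extending by zero (`e' = f' = 0`). -/
def ofKron {V W : Type} [AddCommGroup V] [AddCommGroup W] [Module k V] [Module k W]
    [FiniteDimensional k V] [FiniteDimensional k W] (e f : V →ₗ[k] W) : RudRep k where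
  V₁ := V
  V₂ := W
  e := e
  f := f
  e' := 0
  f' := 0
  rel_ee' := by simp
  rel_e'e := by simp
  rel_ff' := by simp
  rel_f'f := by simp
  rel_ef' := by simp
  rel_e'f := by simp

/-- Build a representation of `Q_Rud` from four matrices satisfying the relations. -/
def ofMatrices {m n : ℕ} (E F : Matrix (Fin n) (Fin m) k) (E' F' : Matrix (Fin m) (Fin n) k)
    (h1 : E * E' = 0) (h2 : E' * E = 0) (h3 : F * F' = 0) (h4 : F' * F = 0)
    (h5 : E * F' = -(F * E')) (h6 : E' * F = -(F' * E)) : RudRep k where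
  V₁ := Fin m → k
  V₂ := Fin n → k
  e := Matrix.toLin' E
  f := Matrix.toLin' F
  e' := Matrix.toLin' E'
  f' := Matrix.toLin' F'
  rel_ee' := by rw [← Matrix.toLin'_mul, h1]; simp
  rel_e'e := by rw [← Matrix.toLin'_mul, h2]; simp
  rel_ff' := by rw [← Matrix.toLin'_mul, h3]; simp
  rel_f'f := by rw [← Matrix.toLin'_mul, h4]; simp
  rel_ef' := by rw [← Matrix.toLin'_mul, ← Matrix.toLin'_mul, h5]; simp
  rel_e'f := by rw [← Matrix.toLin'_mul, ← Matrix.toLin'_mul, h6]; simp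

end RudRep

/-- The projective-injective representation `M`, with `e x₁ = y₁`, `f x₁ = y₂`,
`e' y₂ = x₂`, `f' y₁ = -x₂` on bases `x₁, x₂` of `M₁` and `y₁, y₂` of `M₂`. -/
def repM (k : Type) [Field k] : RudRep k :=
  RudRep.ofMatrices (k := k)
    !![(1 : k), 0; 0, 0] !![(0 : k), 0; 1, 0] !![(0 : k), 0; 0, 1] !![(0 : k), 0; -1, 0]
    (by ext i j; fin_cases i <;> fin_cases j <;>
      simp [Matrix.mul_apply, Fin.sum_univ_two])
    (by ext i j; fin_cases i <;> fin_cases j <;>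
      simp [Matrix.mul_apply, Fin.sum_univ_two])
    (by ext i j; fin_cases i <;> fin_cases j <;>
      simp [Matrix.mul_apply, Fin.sum_univ_two])
    (by ext i j; fin_cases i <;> fin_cases j <;>
      simp [Matrix.mul_apply, Fin.sum_univ_two])
    (by ext i j; fin_cases i <;> fin_cases j <;>
      simp [Matrix.mul_apply, Fin.sum_univ_two])
    (by ext i j; fin_cases i <;> fin_cases j <;>
      simp [Matrix.mul_apply, Fin.sum_univ_two])

/-- The projective-injective representation `M' = σ(M)`. -/
def repM' (k : Type) [Field k] : RudRep k := (repM k).sigma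

namespace RudRep

/-- `(e,f)`-injective: `ker e ⊓ ker f = ⊥`. -/
def EFInj (X : RudRep k) : Prop := LinearMap.ker X.e ⊓ LinearMap.ker X.f = ⊥
/-- `(e,f)`-surjective: `range e ⊔ range f = ⊤`. -/
def EFSurj (X : RudRep k) : Prop := LinearMap.range X.e ⊔ LinearMap.range X.f = ⊤
/-- `(e,f)`-saturated. -/
def EFSat (X : RudRep k) : Prop := X.EFInj ∧ X.EFSurj
/-- `(e',f')`-injective. -/
def EF'Inj (X : RudRep k) : Prop := LinearMap.ker X.e' ⊓ LinearMap.ker X.f' = ⊥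
/-- `(e',f')`-surjective. -/
def EF'Surj (X : RudRep k) : Prop := LinearMap.range X.e' ⊔ LinearMap.range X.f' = ⊤
/-- `(e',f')`-saturated. -/
def EF'Sat (X : RudRep k) : Prop := X.EF'Inj ∧ X.EF'Surj

end RudRep

namespace RudRep

/-- If `Y` is `(e,f)`-surjective, then `e'` takes values in `ker e ⊓ ker f`. -/
lemma EFSurj.e'_mem {Y : RudRep k} (h : Y.EFSurj) (y : Y.V₂) :
    Y.e' y ∈ LinearMap.ker Y.e ⊓ LinearMap.ker Y.f := by
  obtain ⟨_, ⟨a, rfl⟩, _, ⟨b, rfl⟩, rfl⟩ :=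
    Submodule.mem_sup.mp (h.ge (Submodule.mem_top (x := y)))
  refine ⟨Y.ee'_apply _, ?_⟩
  rw [SetLike.mem_coe, LinearMap.mem_ker, map_add, e'e_apply, zero_add,
    e'f_apply, map_neg, ff'_apply, neg_zero]

/-- If `Y` is `(e,f)`-surjective, then `f'` takes values in `ker e ⊓ ker f`. -/
lemma EFSurj.f'_mem {Y : RudRep k} (h : Y.EFSurj) (y : Y.V₂) :
    Y.f' y ∈ LinearMap.ker Y.e ⊓ LinearMap.ker Y.f := by
  refine ⟨?_, Y.ff'_apply _⟩
  rw [SetLike.mem_coe, LinearMap.mem_ker, ef'_apply, LinearMap.mem_ker.mp (h.e'_mem y).2, neg_zero]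

end RudRep

/-- If `Y` is `(e,f)`-surjective then
`Im(e') + Im(f') ⊆ ker(e) + ker(f)`; if `Y` is `(e,f)`-saturated then `e' = 0 = f'`. -/
theorem ef_surjective_controls_e'f' (k : Type) [Field k] (Y : RudRep k) :
    (Y.EFSurj →
      LinearMap.range Y.e' ⊔ LinearMap.range Y.f' ≤ LinearMap.ker Y.e ⊔ LinearMap.ker Y.f) ∧
    (Y.EFSat → Y.e' = 0 ∧ Y.f' = 0) := by
  refine ⟨fun _ => sup_le_sup ?_ ?_, fun ⟨hinj, hsurj⟩ => ⟨?_, ?_⟩⟩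
  · exact LinearMap.range_le_ker_iff.mpr Y.rel_ee'
  · exact LinearMap.range_le_ker_iff.mpr Y.rel_ff'
  · ext y
    exact (Submodule.mem_bot k).mp (hinj.le (hsurj.e'_mem y))
  · ext y
    exact (Submodule.mem_bot k).mp (hinj.le (hsurj.f'_mem y))
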